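/- Pinkus classification of closed TDI-subspaces: let V be a closed ℝ-linear subspace of the space C(ℝ^d, ℝ) of continuous functions with the topology of uniform convergence on compact sets (compact-open topology), such that for all a, b ∈ ℝ^d and every f ∈ V the function x ↦ f(a·x + b) also belongs to V (where a·x is the componentwise product). Then there exists a finite set T of elements of (ℕ ∪ {∞})^d such that V equals the closure of the linear span of the monomial functions {x ↦ x^β : β ∈ ℕ^d and β ≤ n componentwise for some n ∈ T}, where β ≤ n uses the order on ℕ ∪ {∞} in which every natural number is less than ∞. -/

import Mathlib

open Filter Topology

namespace TDI

abbrev X (d : ℕ) := Fin d → ℝ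
abbrev E (d : ℕ) := C((Fin d → ℝ), ℝ)

lemma mem_clos {d : ℕ} {S : Set (E d)} {g : E d}
    (h : ∀ R > 0, ∀ ε > 0, ∃ v ∈ S, ∀ x : X d, ‖x‖ ≤ R → |v x - g x| ≤ ε) : g ∈ closure S := by
  have hb := nhds_basis_uniformity'
    (Metric.uniformity_basis_dist (α := ℝ)).compactConvergenceUniformity (x := g)
  rw [mem_closure_iff_nhds_basis hb]
  rintro ⟨K, ε⟩ ⟨hK, hε⟩
  obtain ⟨R, hR0, hR⟩ := hK.isBounded.exists_pos_norm_le
  obtain ⟨v, hv, hv'⟩ := h R hR0 (ε / 2) (half_pos hε)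
  refine ⟨v, hv, fun x hx => ?_⟩
  have := hv' x (hR x hx)
  simp only [Set.mem_ofPred_eq, Real.dist_eq]
  change |g x - v x| < ε
  rw [abs_sub_comm]; linarith [show (0:ℝ) < ε from hε]

lemma approx_of_mem_clos {d : ℕ} {S : Set (E d)} {g : E d} (h : g ∈ closure S) :
    ∀ R > 0, ∀ ε > 0, ∃ v ∈ S, ∀ x : X d, ‖x‖ ≤ R → |v x - g x| ≤ ε := by
  intro R hR ε hε
  have hb := nhds_basis_uniformity'
    (Metric.uniformity_basis_dist (α := ℝ)).compactConvergenceUniformity (x := g)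
  rw [mem_closure_iff_nhds_basis hb] at h
  obtain ⟨v, hv, hv'⟩ := h (Metric.closedBall 0 R, ε) ⟨isCompact_closedBall _ _, hε⟩
  refine ⟨v, hv, fun x hx => ?_⟩
  have : dist (g x) (v x) < ε := hv' x (by simpa using hx)
  rw [Real.dist_eq, abs_sub_comm] at this
  exact this.le

/-- shift operator -/
def sh {d : ℕ} (e : X d) (t : ℝ) : Module.End ℝ (E d) where
  toFun f := f.comp ⟨fun x => x + t • e, by fun_prop⟩
  map_add' f g := by ext x; simp
  map_smul' f g := by ext x; simp

lemma sh_apply {d : ℕ} (e : X d) (t : ℝ) (f : E d) (x : X d) : sh e t f x = f (x + t • e) := rfl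

/-- integral operator -/
noncomputable def av {d : ℕ} (e : X d) (h : ℝ) : Module.End ℝ (E d) where
  toFun f := ⟨fun x => ∫ s in (0:ℝ)..h, f (x + s • e), by fun_prop⟩
  map_add' f g := by
    ext x
    simp only [ContinuousMap.coe_mk, ContinuousMap.add_apply]
    apply intervalIntegral.integral_add <;>
    exact Continuous.intervalIntegrable (by fun_prop) _ _
  map_smul' f g := by ext x; simp

lemma av_apply {d : ℕ} (e : X d) (h : ℝ) (f : E d) (x : X d) :
    av e h f x = ∫ s in (0:ℝ)..h, f (x + s • e) := rfl

/-- difference operator -/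
def df {d : ℕ} (e : X d) (t : ℝ) : Module.End ℝ (E d) := sh e t - 1

lemma df_apply {d : ℕ} (e : X d) (t : ℝ) (f : E d) (x : X d) :
    df e t f x = f (x + t • e) - f x := rfl

lemma df_mul_av {d : ℕ} (e : X d) (u h : ℝ) : df e u * av e h = av e u * df e h := by
  ext f x
  simp only [Module.End.mul_apply, df_apply, av_apply]
  have hc : Continuous fun s : ℝ => f (x + s • e) := by fun_prop
  have hi : ∀ a b : ℝ, IntervalIntegrable (fun s : ℝ => f (x + s • e)) MeasureTheory.volume a b :=
    fun a b => hc.intervalIntegrable a b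
  rw [intervalIntegral.integral_sub (Continuous.intervalIntegrable (by fun_prop) _ _) (hi _ _)]
  have h1 : ∫ s in (0:ℝ)..h, f (x + u • e + s • e) = ∫ s in u..(h+u), f (x + s • e) := by
    have := intervalIntegral.integral_comp_add_right (a := 0) (b := h) (fun s => f (x + s • e)) u
    rw [zero_add] at this
    rw [← this]
    congr 1; ext s; congr 1; module
  have h2 : ∫ s in (0:ℝ)..u, f (x + s • e + h • e) = ∫ s in h..(u+h), f (x + s • e) := by
    have := intervalIntegral.integral_comp_add_right (a := 0) (b := u) (fun s => f (x + s • e)) h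
    rw [zero_add] at this
    rw [← this]
    congr 1; ext s; congr 1; module
  rw [h1, h2]
  have a1 := intervalIntegral.integral_add_adjacent_intervals (hi 0 u) (hi u (h+u))
  have a2 := intervalIntegral.integral_add_adjacent_intervals (hi 0 h) (hi h (u+h))
  rw [add_comm u h] at *
  linarith

lemma commute_df_av {d : ℕ} (e : X d) (u h : ℝ) : Commute (df e u) (av e h) := by
  ext f x
  simp only [Module.End.mul_apply, df_apply, av_apply]
  rw [intervalIntegral.integral_sub (Continuous.intervalIntegrable (by fun_prop) _ _)
    (Continuous.intervalIntegrable (by fun_prop) _ _)]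
  congr 2; ext s; congr 1; module

lemma df_pow_mul_av_pow {d : ℕ} (e : X d) (u h : ℝ) (m : ℕ) :
    df e u ^ m * av e h ^ m = av e u ^ m * df e h ^ m := by
  rw [← (commute_df_av e u h).mul_pow, df_mul_av, (commute_df_av e h u).symm.mul_pow]

lemma sh_pow {d : ℕ} (e : X d) (t : ℝ) (k : ℕ) (f : E d) (x : X d) :
    (sh e t ^ k) f x = f (x + (k * t) • e) := by
  induction k generalizing f x with
  | zero => simp
  | succ k ih =>
    rw [pow_succ, Module.End.mul_apply, ih, sh_apply]
    congr 1; push_cast; module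

lemma df_pow_apply {d : ℕ} (e : X d) (t : ℝ) (m : ℕ) (f : E d) (x : X d) :
    (df e t ^ m) f x =
      ∑ k ∈ Finset.range (m + 1), ((-1) ^ (m - k) * (m.choose k : ℝ)) * f (x + (k * t) • e) := by
  have : df e t = sh e t + (-1 : ℝ) • 1 := by rw [df]; module
  rw [this, Commute.add_pow ((Commute.one_right _).smul_right _)]
  rw [LinearMap.sum_apply, ContinuousMap.sum_apply]
  refine Finset.sum_congr rfl fun k _ => ?_
  rw [smul_pow, one_pow, mul_smul_comm, mul_one, ← nsmul_eq_mul', LinearMap.smul_apply,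
    LinearMap.smul_apply, ContinuousMap.smul_apply, ContinuousMap.smul_apply, sh_pow]
  simp only [nsmul_eq_mul, smul_eq_mul]; ring

/-- Bernstein identity -/
lemma bern_id {d : ℕ} (e : X d) (t y : ℝ) (n : ℕ) (f : E d) (x : X d) :
    ∑ k ∈ Finset.range (n + 1), ((n.choose k : ℝ) * y ^ k) * (df e t ^ k) f x =
    ∑ k ∈ Finset.range (n + 1), ((n.choose k : ℝ) * y ^ k * (1 - y) ^ (n - k))
      * f (x + (k * t) • e) := by
  have h1 : y • df e t + (1:ℝ) • 1 = y • sh e t + (1 - y) • 1 := by rw [df]; module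
  have key : ∀ (A : Module.End ℝ (E d)) (c : ℝ), ((y • A + c • 1) ^ n) f x =
      ∑ k ∈ Finset.range (n + 1), ((n.choose k : ℝ) * y ^ k * c ^ (n - k)) * (A ^ k) f x := by
    intro A c
    rw [Commute.add_pow ((Commute.one_right _).smul_right _)]
    rw [LinearMap.sum_apply, ContinuousMap.sum_apply]
    refine Finset.sum_congr rfl fun k _ => ?_
    rw [smul_pow, smul_pow, one_pow, mul_smul_comm, mul_one, ← nsmul_eq_mul', LinearMap.smul_apply,
      LinearMap.smul_apply, LinearMap.smul_apply, ContinuousMap.smul_apply,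
      ContinuousMap.smul_apply, ContinuousMap.smul_apply]
    simp only [nsmul_eq_mul, smul_eq_mul]; ring
  have h2 := key (df e t) 1
  rw [h1, key] at h2
  simp only [one_pow, mul_one, sh_pow] at h2
  exact h2.symm

lemma av_pow_bound {d : ℕ} (e : X d) (u : ℝ) (F : E d) (c ε : ℝ) (z : X d) (m : ℕ) :
    ∀ r : ℝ, 0 ≤ r → (∀ t : ℝ, |t| ≤ r + m * |u| → |F (z + t • e) - c| ≤ ε) →
      ∀ t : ℝ, |t| ≤ r → |(av e u ^ m) F (z + t • e) - u ^ m * c| ≤ |u| ^ m * ε := by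
  induction m with
  | zero => intro r hr h t ht; simpa using h t (by simpa using ht)
  | succ m ih =>
    intro r hr h t ht
    have ih' := ih (r + |u|) (by positivity) (fun t ht => h t (by push_cast; linarith))
    rw [pow_succ', Module.End.mul_apply, av_apply]
    have : (∫ s in (0:ℝ)..u, (av e u ^ m) F (z + t • e + s • e)) - u ^ (m+1) * c =
        ∫ s in (0:ℝ)..u, ((av e u ^ m) F (z + t • e + s • e) - u ^ m * c) := by
      rw [intervalIntegral.integral_sub (Continuous.intervalIntegrable (by fun_prop) _ _)
        (Continuous.intervalIntegrable (by fun_prop) _ _)]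
      simp; ring
    rw [this]
    have := intervalIntegral.norm_integral_le_of_norm_le_const (a := 0) (b := u)
      (f := fun s => (av e u ^ m) F (z + t • e + s • e) - u ^ m * c) (C := |u| ^ m * ε) ?_
    · rw [Real.norm_eq_abs, sub_zero] at this
      rw [pow_succ]; linarith
    · intro s hs
      rw [Real.norm_eq_abs, add_assoc, ← add_smul]
      apply ih'
      have : |s| ≤ |u| := by
        rw [Set.mem_uIoc] at hs
        rcases hs with hs | hs
        · rw [abs_of_pos hs.1, abs_of_pos (hs.1.trans_le hs.2)]; exact hs.2
        · rw [abs_of_nonpos hs.2, abs_of_neg (hs.1.trans_le hs.2)]; linarith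
      exact (abs_add_le _ _).trans (add_le_add ht this)

lemma uc {d : ℕ} (f : E d) (R ε : ℝ) (hε : 0 < ε) : ∃ δ > 0, ∀ p q : X d, ‖p‖ ≤ R → ‖q‖ ≤ R →
    ‖p - q‖ < δ → |f p - f q| ≤ ε := by
  have h := (isCompact_closedBall (0 : X d) R).uniformContinuousOn_of_continuous
    (f := f) (by fun_prop)
  rw [Metric.uniformContinuousOn_iff] at h
  obtain ⟨δ, hδ, h⟩ := h ε hε
  refine ⟨δ, hδ, fun p q hp hq hpq => ?_⟩
  have := h p (by simpa using hp) q (by simpa using hq) (by rwa [dist_eq_norm])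
  exact this.le

lemma av_mem {d : ℕ} (V : Submodule ℝ (E d)) (hclosed : IsClosed (V : Set (E d))) (e : X d)
    (hsh : ∀ f ∈ V, ∀ t, sh e t f ∈ V) (h : ℝ) (hh : 0 ≤ h) (f : E d) (hf : f ∈ V) :
    av e h f ∈ V := by
  rw [← SetLike.mem_coe, ← hclosed.closure_eq]
  apply mem_clos
  intro R hR ε hε
  obtain ⟨δ, hδ, hu⟩ := uc f (R + h * ‖e‖) (ε / (h + 1)) (by positivity)
  obtain ⟨N, hN⟩ := exists_nat_gt (h * ‖e‖ / δ)
  have hN0 : (0 : ℝ) < N := lt_of_le_of_lt (by positivity) hN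
  have hN1 : h / N * ‖e‖ < δ := by
    rw [div_lt_iff₀ hδ] at hN
    rw [div_mul_eq_mul_div, div_lt_iff₀ hN0]; linarith
  refine ⟨∑ j ∈ Finset.range N, (h / N) • sh e (j * (h / N)) f,
    V.sum_mem fun j _ => V.smul_mem _ (hsh f hf _), fun x hx => ?_⟩
  have hc : Continuous fun s : ℝ => f (x + s • e) := by fun_prop
  have e1 : av e h f x = ∑ j ∈ Finset.range N,
      ∫ s in (j * (h / N) : ℝ)..((j + 1 : ℕ) * (h / N) : ℝ), f (x + s • e) := by
    rw [av_apply, intervalIntegral.sum_integral_adjacent_intervals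
      (a := fun j : ℕ => (j * (h / N) : ℝ)) (fun k _ => hc.intervalIntegrable _ _)]
    congr 1
    · simp
    · field_simp
  rw [e1, ContinuousMap.sum_apply, ← Finset.sum_sub_distrib]
  have hstep : 0 ≤ h / N := by positivity
  have e2 : ∀ j ∈ Finset.range N, |((h / N) • sh e (j * (h / N)) f) x -
      ∫ s in (j * (h / N) : ℝ)..((j + 1 : ℕ) * (h / N) : ℝ), f (x + s • e)|
      ≤ ε / (h + 1) * (h / N) := by
    intro j hj
    have hj' : ((j : ℝ) + 1) ≤ N := by exact_mod_cast Finset.mem_range.1 hj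
    have : (∫ s in (j * (h / N) : ℝ)..((j + 1 : ℕ) * (h / N) : ℝ), f (x + s • e)) -
        ((h / N) • sh e (j * (h / N)) f) x =
        ∫ s in (j * (h / N) : ℝ)..((j + 1 : ℕ) * (h / N) : ℝ),
          (f (x + s • e) - f (x + ((j * (h / N) : ℝ)) • e)) := by
      rw [intervalIntegral.integral_sub (hc.intervalIntegrable _ _)
        (Continuous.intervalIntegrable (by fun_prop) _ _), intervalIntegral.integral_const]
      rw [ContinuousMap.smul_apply, sh_apply]
      simp only [smul_eq_mul]; push_cast; ring
    rw [abs_sub_comm, this]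
    have hle : (j * (h / N) : ℝ) ≤ ((j + 1 : ℕ) * (h / N) : ℝ) := by
      push_cast; nlinarith
    have hlast : ((j + 1 : ℕ) * (h / N) : ℝ) ≤ h := by
      push_cast
      calc ((j:ℝ) + 1) * (h / N) ≤ N * (h / N) := by gcongr
        _ = h := by field_simp
    have hj0 : 0 ≤ (j * (h / N) : ℝ) := by positivity
    have := intervalIntegral.norm_integral_le_of_norm_le_const
      (a := (j * (h / N) : ℝ)) (b := ((j + 1 : ℕ) * (h / N) : ℝ))
      (f := fun s => f (x + s • e) - f (x + ((j * (h / N) : ℝ)) • e)) (C := ε / (h + 1)) ?_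
    · rw [Real.norm_eq_abs, abs_of_nonneg (sub_nonneg.2 hle)] at this
      refine this.trans (le_of_eq ?_)
      push_cast; ring
    · intro s hs
      rw [Set.uIoc_of_le hle] at hs
      have hb : ∀ r : ℝ, 0 ≤ r → r ≤ h → ‖x + r • e‖ ≤ R + h * ‖e‖ := by
        intro r hr hr'
        refine (norm_add_le _ _).trans (add_le_add hx ?_)
        rw [norm_smul, Real.norm_eq_abs, abs_of_nonneg hr]; gcongr
      rw [Real.norm_eq_abs]
      apply hu _ _ (hb _ (hj0.trans hs.1.le) (hs.2.trans hlast)) (hb _ hj0 (hle.trans hlast))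
      have : x + s • e - (x + (j * (h / N) : ℝ) • e) = (s - j * (h / N)) • e := by module
      rw [this, norm_smul, Real.norm_eq_abs, abs_of_nonneg (by linarith [hs.1])]
      refine lt_of_le_of_lt ?_ hN1
      gcongr
      have := hs.2
      push_cast at this
      linarith
  refine (Finset.abs_sum_le_sum_abs _ _).trans ((Finset.sum_le_sum e2).trans ?_)
  rw [Finset.sum_const, Finset.card_range, nsmul_eq_mul]
  have : (N:ℝ) * (ε / (h + 1) * (h / N)) = ε * (h / (h + 1)) := by field_simp
  rw [this]
  have : h / (h + 1) ≤ 1 := by rw [div_le_one (by positivity)]; linarith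
  nlinarith

/-- update by an affine function -/
def um {d : ℕ} (i : Fin d) (a b : ℝ) : C(X d, X d) :=
  ⟨fun x => Function.update x i (a * x i + b), by fun_prop⟩

lemma um_apply {d : ℕ} (i : Fin d) (a b : ℝ) (x : X d) :
    um i a b x = Function.update x i (a * x i + b) := rfl

lemma upd_add {d : ℕ} (i : Fin d) (b t : ℝ) (x : X d) :
    Function.update x i b + t • Pi.single i (1:ℝ) = Function.update x i (b + t) := by
  ext j
  by_cases h : j = i
  · subst h; simp
  · simp [h]

/-- invariance -/
def Inv {d : ℕ} (V : Submodule ℝ (E d)) : Prop := ∀ f ∈ V, ∀ a b : Fin d → ℝ,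
      (ContinuousMap.comp f ⟨fun x => a * x + b, by continuity⟩ : C((Fin d → ℝ), ℝ)) ∈ V

lemma Inv.um {d : ℕ} {V : Submodule ℝ (E d)} (hV : Inv V) {f : E d} (hf : f ∈ V) (i : Fin d)
    (a b : ℝ) : f.comp (um i a b) ∈ V := by
  convert hV f hf (Function.update 1 i a) (Pi.single i b) using 1
  ext x
  simp only [ContinuousMap.comp_apply, ContinuousMap.coe_mk, um_apply]
  congr 1
  ext j
  by_cases h : j = i
  · subst h; simp
  · simp [h]

lemma Inv.sh {d : ℕ} {V : Submodule ℝ (E d)} (hV : Inv V) {f : E d} (hf : f ∈ V) (e : X d)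
    (t : ℝ) : sh e t f ∈ V := by
  convert hV f hf 1 (t • e) using 1
  ext x
  simp [sh_apply]

/-- coordinate -/
def cd {d : ℕ} (i : Fin d) : E d := ⟨fun x => x i, by fun_prop⟩

lemma norm_upd {d : ℕ} (i : Fin d) (b : ℝ) (x : X d) : ‖Function.update x i b‖ ≤ ‖x‖ + |b| := by
  rw [pi_norm_le_iff_of_nonneg (by positivity)]
  intro j
  by_cases h : j = i
  · subst h; simp
  · simp only [Function.update_of_ne h]
    linarith [norm_le_pi_norm x j, abs_nonneg b]

lemma mono_mem {d : ℕ} (V : Submodule ℝ (E d)) (hclosed : IsClosed (V : Set (E d)))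
    (hV : Inv V) (i : Fin d) (m : ℕ) (b h : ℝ) (hh : 0 ≤ h) (f : E d) (hf : f ∈ V) :
    cd i ^ m * ((df (Pi.single i 1) h ^ m) f).comp (um i 0 b) ∈ V := by
  set e : X d := Pi.single i 1 with he
  set F := (df e h ^ m) f with hF
  have hg : ∀ k : ℕ, (av e h ^ k) f ∈ V := by
    intro k
    induction k with
    | zero => simpa using hf
    | succ k ih =>
      rw [pow_succ', Module.End.mul_apply]
      exact av_mem V hclosed e (fun f hf t => hV.sh hf e t) h hh _ ih
  set g := (av e h ^ m) f with hgdef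
  rw [← SetLike.mem_coe, ← hclosed.closure_eq]
  apply mem_clos
  intro R hR ε hε
  obtain ⟨δ, hδ, hu⟩ := uc F (R + |b| + 1) (ε / R ^ m) (by positivity)
  set a := min δ 1 / (m * R + 1) with ha
  have hmin : 0 < min δ 1 := by positivity
  have ha0 : 0 < a := by positivity
  have ha1 : m * (a * R) < min δ 1 := by
    rw [ha]
    have : m * (min δ 1 / (m * R + 1) * R) = min δ 1 * ((m * R) / (m * R + 1)) := by ring
    rw [this]
    have : (m * R) / (m * R + 1) < 1 := by rw [div_lt_one (by positivity)]; linarith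
    nlinarith
  refine ⟨(a ^ m)⁻¹ • ∑ k ∈ Finset.range (m + 1), ((-1) ^ (m - k) * (m.choose k : ℝ)) •
    g.comp (um i (k * a) b), V.smul_mem _ (V.sum_mem fun k _ => V.smul_mem _
      (hV.um (hg m) i _ _)), fun x hx => ?_⟩
  set z := Function.update x i b with hz
  have e1 : (∑ k ∈ Finset.range (m + 1), ((-1) ^ (m - k) * (m.choose k : ℝ)) •
    g.comp (um i (k * a) b)) x = (av e (a * x i) ^ m) F z := by
    rw [hF, ← Module.End.mul_apply, ← df_pow_mul_av_pow, Module.End.mul_apply, df_pow_apply,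
      ContinuousMap.sum_apply]
    refine Finset.sum_congr rfl fun k _ => ?_
    rw [ContinuousMap.smul_apply, ContinuousMap.comp_apply, um_apply, hz, he, upd_add, smul_eq_mul]
    congr 3; ring
  have hxi : |x i| ≤ R := (norm_le_pi_norm x i).trans hx
  have hzn : ‖z‖ ≤ R + |b| := (norm_upd i b x).trans (by linarith)
  have hen : ‖e‖ = 1 := by rw [he, Pi.norm_single]; simp
  have e2 := av_pow_bound e (a * x i) F (F z) (ε / R ^ m) z m 0 le_rfl (by
    intro t ht
    have ht' : |t| < min δ 1 := by
      refine lt_of_le_of_lt ht (lt_of_le_of_lt ?_ ha1)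
      rw [zero_add, abs_mul, abs_of_pos ha0]; gcongr
    have htn : ‖t • e‖ = |t| := by rw [norm_smul, hen, Real.norm_eq_abs, mul_one]
    apply hu
    · refine (norm_add_le _ _).trans ?_
      rw [htn]; linarith [min_le_right δ 1]
    · linarith
    · rw [add_sub_cancel_left, htn]; exact ht'.trans_le (min_le_left _ _)) 0 (by simp)
  rw [zero_smul, add_zero] at e2
  have e3 : (cd i ^ m * F.comp (um i 0 b)) x = x i ^ m * F z := by
    simp [cd, um_apply, hz]
  rw [ContinuousMap.smul_apply, e1, e3, smul_eq_mul]
  have e4 : (a ^ m)⁻¹ * (av e (a * x i) ^ m) F z - x i ^ m * F z =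
      (a ^ m)⁻¹ * ((av e (a * x i) ^ m) F z - (a * x i) ^ m * F z) := by
    rw [mul_pow]; field_simp
  rw [e4, abs_mul, abs_of_pos (by positivity)]
  calc (a ^ m)⁻¹ * |(av e (a * x i) ^ m) F z - (a * x i) ^ m * F z|
      ≤ (a ^ m)⁻¹ * (|a * x i| ^ m * (ε / R ^ m)) := by gcongr
    _ = |x i| ^ m * (ε / R ^ m) := by
      rw [abs_mul, abs_of_pos ha0, mul_pow]; field_simp
    _ ≤ R ^ m * (ε / R ^ m) := by gcongr
    _ = ε := by field_simp

/-- Bernstein operator in coordinate `i` on `[-R, R]`. -/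
noncomputable def B {d : ℕ} (i : Fin d) (R : ℝ) (n : ℕ) (f : E d) : E d :=
  ∑ k ∈ Finset.range (n + 1), (n.choose k : ℝ) •
    (((1 / (2 * R)) • cd i + algebraMap ℝ (E d) (1 / 2)) ^ k *
      ((df (Pi.single i 1) (2 * R / n) ^ k) f).comp (um i 0 (-R)))

lemma B_mem {d : ℕ} (V : Submodule ℝ (E d)) (hclosed : IsClosed (V : Set (E d)))
    (hV : Inv V) (i : Fin d) (R : ℝ) (hR : 0 < R) (n : ℕ) (f : E d) (hf : f ∈ V) :
    B i R n f ∈ V := by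
  refine V.sum_mem fun k _ => V.smul_mem _ ?_
  have h := hV.um (mono_mem V hclosed hV i k (-R) (2 * R / n) (by positivity) f hf) i
    (1 / (2 * R)) (1 / 2)
  convert h using 1
  ext x
  simp [um_apply, cd]

/-- functions that are polynomial in the coordinates in `s` -/
noncomputable def S {d : ℕ} (s : Finset (Fin d)) : Subalgebra ℝ (E d) :=
  Algebra.adjoin ℝ ({f | ∃ i ∈ s, f = cd i} ∪
    {f | ∀ x y : X d, (∀ j ∉ s, x j = y j) → f x = f y})

lemma S_um {d : ℕ} (s : Finset (Fin d)) (i : Fin d) (c : ℝ) (f : E d) (hf : f ∈ S s) :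
    f.comp (um i 0 c) ∈ S (insert i s) := by
  unfold S at hf
  induction hf using Algebra.adjoin_induction with
  | mem f hf =>
    rcases hf with ⟨j, hj, rfl⟩ | hf
    · by_cases hji : j = i
      · subst hji
        have : (cd j).comp (um j 0 c) = algebraMap ℝ (E d) c := by
          ext x; simp [cd, um_apply]
        rw [this]; exact Subalgebra.algebraMap_mem _ _
      · have : (cd j).comp (um i 0 c) = cd j := by
          ext x; simp [cd, um_apply, hji]
        rw [this]
        exact Algebra.subset_adjoin (Or.inl ⟨j, Finset.mem_insert_of_mem hj, rfl⟩)
    · refine Algebra.subset_adjoin (Or.inr fun x y hxy => ?_)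
      apply hf
      intro j hj
      by_cases hji : j = i
      · subst hji; simp [um_apply]
      · simp only [um_apply, Function.update_of_ne hji]
        exact hxy j (by simp [hji, hj])
  | algebraMap r => exact Subalgebra.algebraMap_mem _ r
  | add f g _ _ h1 h2 => exact Subalgebra.add_mem _ h1 h2
  | mul f g _ _ h1 h2 => exact Subalgebra.mul_mem _ h1 h2

lemma B_mem_S {d : ℕ} (s : Finset (Fin d)) (i : Fin d) (R : ℝ) (n : ℕ) (f : E d) (hf : f ∈ S s) :
    B i R n f ∈ S (insert i s) := by
  refine Subalgebra.sum_mem _ fun k _ => Subalgebra.smul_mem _ (Subalgebra.mul_mem _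
    (Subalgebra.pow_mem _ (Subalgebra.add_mem _ (Subalgebra.smul_mem _ ?_ _)
      (Subalgebra.algebraMap_mem _ _)) _) ?_) _
  · exact Algebra.subset_adjoin (Or.inl ⟨i, Finset.mem_insert_self _ _, rfl⟩)
  · have : ((df (Pi.single i 1) (2 * R / n) ^ k) f).comp (um i 0 (-R)) =
        ∑ j ∈ Finset.range (k + 1), ((-1) ^ (k - j) * (k.choose j : ℝ)) •
          f.comp (um i 0 (-R + j * (2 * R / n))) := by
      ext x
      rw [ContinuousMap.comp_apply, df_pow_apply, ContinuousMap.sum_apply]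
      refine Finset.sum_congr rfl fun j _ => ?_
      rw [um_apply, upd_add]
      simp [um_apply]
    rw [this]
    exact Subalgebra.sum_mem _ fun j _ => Subalgebra.smul_mem _ (S_um s i _ f hf) _

lemma B_approx {d : ℕ} (i : Fin d) (R : ℝ) (hR : 0 < R) (f : E d) (ε : ℝ) (hε : 0 < ε) :
    ∃ n : ℕ, ∀ x : X d, ‖x‖ ≤ R → |B i R n f x - f x| ≤ ε := by
  let F0 : C(unitInterval × X d, ℝ) :=
    ⟨fun p => f (Function.update p.2 i (-R + 2 * R * p.1)), by fun_prop⟩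
  let F : C(unitInterval, E d) := F0.curry
  have h1 := bernsteinApproximation_uniform F
  have h2 := (ContinuousMap.continuous_uncurry (X := unitInterval) (Y := X d) (Z := ℝ)).tendsto F
    |>.comp h1
  rw [ContinuousMap.tendsto_iff_forall_isCompact_tendstoUniformlyOn] at h2
  have h3 := h2 (Set.univ ×ˢ Metric.closedBall 0 R)
    (isCompact_univ.prod (isCompact_closedBall _ _))
  rw [Metric.tendstoUniformlyOn_iff] at h3
  obtain ⟨n, hn⟩ := (h3 ε hε).exists
  refine ⟨n, fun x hx => ?_⟩
  have hxi : |x i| ≤ R := (norm_le_pi_norm x i).trans hx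
  rw [abs_le] at hxi
  let y : unitInterval := ⟨(x i + R) / (2 * R), by
    rw [Set.mem_Icc, le_div_iff₀ (by positivity), div_le_one (by positivity)]
    constructor <;> linarith⟩
  have h4 := hn (y, x) ⟨trivial, by simpa using hx⟩
  rw [Real.dist_eq, abs_sub_comm] at h4
  have e1 : (F.uncurry : C(unitInterval × X d, ℝ)) (y, x) = f x := by
    change f (Function.update x i (-R + 2 * R * ((x i + R) / (2 * R)))) = f x
    congr 1
    rw [show -R + 2 * R * ((x i + R) / (2 * R)) = x i by field_simp; ring]
    simp
  have e2 : B i R n f x = (bernsteinApproximation n F).uncurry (y, x) := by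
    change _ = (bernsteinApproximation n F y) x
    rw [bernsteinApproximation.apply, ContinuousMap.sum_apply]
    have := bern_id (Pi.single i 1) (2 * R / n) ((x i + R) / (2 * R)) n f (Function.update x i (-R))
    have e3 : B i R n f x = ∑ k ∈ Finset.range (n + 1),
        ((n.choose k : ℝ) * ((x i + R) / (2 * R)) ^ k) *
          (df (Pi.single i 1) (2 * R / n) ^ k) f (Function.update x i (-R)) := by
      rw [B, ContinuousMap.sum_apply]
      refine Finset.sum_congr rfl fun k _ => ?_
      have : (x i + R) / (2 * R) = (1 / (2 * R)) * x i + 1 / 2 := by field_simp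
      rw [this]
      simp [um_apply, cd, mul_assoc]
    rw [e3, this, Finset.sum_range]
    refine Finset.sum_congr rfl fun k _ => ?_
    rw [ContinuousMap.smul_apply, bernstein_apply, smul_eq_mul, upd_add]
    congr 1
    change _ = f (Function.update x i (-R + 2 * R * ((k : ℝ) / n)))
    congr 2
    ring
  rw [e2]
  rw [e1] at h4
  exact h4.le

lemma dense_S {d : ℕ} (V : Submodule ℝ (E d)) (hclosed : IsClosed (V : Set (E d)))
    (hV : Inv V) (s : Finset (Fin d)) : (V : Set (E d)) ⊆ closure {f | f ∈ V ∧ f ∈ S s} := by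
  induction s using Finset.induction_on with
  | empty =>
    intro f hf
    exact subset_closure ⟨hf, Algebra.subset_adjoin (Or.inr fun x y h => by
      rw [show x = y from funext fun j => h j (by simp)])⟩
  | insert i s _ ih =>
    refine ih.trans (closure_minimal ?_ isClosed_closure)
    rintro f ⟨hf, hfs⟩
    apply mem_clos
    intro R hR ε hε
    obtain ⟨n, hn⟩ := B_approx i R hR f ε hε
    exact ⟨_, ⟨B_mem V hclosed hV i R hR n f hf, B_mem_S s i R n f hfs⟩, hn⟩

lemma S_univ {d : ℕ} (f : E d) (hf : f ∈ S (Finset.univ : Finset (Fin d))) :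
    ∃ p : MvPolynomial (Fin d) ℝ, ∀ x, f x = MvPolynomial.eval x p := by
  unfold S at hf
  induction hf using Algebra.adjoin_induction with
  | mem f hf =>
    rcases hf with ⟨j, hj, rfl⟩ | hf
    · exact ⟨MvPolynomial.X j, fun x => by simp [cd]⟩
    · exact ⟨MvPolynomial.C (f 0), fun x => by simpa using hf x 0 (by simp)⟩
  | algebraMap r => exact ⟨MvPolynomial.C r, fun x => by simp⟩
  | add f g _ _ h1 h2 =>
    obtain ⟨p, hp⟩ := h1
    obtain ⟨q, hq⟩ := h2
    exact ⟨p + q, fun x => by simp [hp, hq]⟩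
  | mul f g _ _ h1 h2 =>
    obtain ⟨p, hp⟩ := h1
    obtain ⟨q, hq⟩ := h2
    exact ⟨p * q, fun x => by simp [hp, hq]⟩

/-- monomial function -/
def mon {d : ℕ} (β : Fin d → ℕ) : E d := ⟨fun x => ∏ i, x i ^ β i, by continuity⟩

lemma extract {d : ℕ} (V : Submodule ℝ (E d)) (s : Finset (Fin d →₀ ℕ))
    (v : (Fin d →₀ ℕ) → E d) (h : ∀ a : Fin d → ℝ, ∑ γ ∈ s, (∏ i, a i ^ γ i) • v γ ∈ V) :
    ∀ γ ∈ s, v γ ∈ V := by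
  intro γ hγ
  rw [← Submodule.Quotient.mk_eq_zero, ← Module.forall_dual_apply_eq_zero_iff ℝ]
  intro φ
  let p : MvPolynomial (Fin d) ℝ := ∑ γ ∈ s, MvPolynomial.monomial γ (φ (V.mkQ (v γ)))
  have hp : p = 0 := by
    apply MvPolynomial.funext
    intro a
    have := (Submodule.Quotient.mk_eq_zero V).2 (h a)
    have := congrArg φ this
    rw [← Submodule.mkQ_apply] at this
    simp only [map_sum, map_smul, map_zero, smul_eq_mul] at this
    simp only [p, map_sum, MvPolynomial.eval_monomial, map_zero]
    rw [← this]
    refine Finset.sum_congr rfl fun γ _ => ?_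
    rw [Finsupp.prod_fintype _ _ (by simp), mul_comm]
  have := congrArg (MvPolynomial.coeff γ) hp
  simp only [p, MvPolynomial.coeff_sum, MvPolynomial.coeff_monomial, MvPolynomial.coeff_zero] at this
  simpa [hγ] using this

lemma poly_mem {d : ℕ} (V : Submodule ℝ (E d)) (hV : Inv V) (f : E d) (hf : f ∈ V)
    (p : MvPolynomial (Fin d) ℝ) (hp : ∀ x, f x = MvPolynomial.eval x p) (γ : Fin d →₀ ℕ)
    (hγ : MvPolynomial.coeff γ p ≠ 0) : mon γ ∈ V := by
  have := extract V p.support (fun γ => MvPolynomial.coeff γ p • mon γ) (fun a => by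
    convert hV f hf a 0 using 1
    ext x
    simp only [ContinuousMap.sum_apply, ContinuousMap.comp_apply, hp, MvPolynomial.eval_eq']
    refine Finset.sum_congr rfl fun γ _ => ?_
    simp [mon, mul_pow, Finset.prod_mul_distrib]
    ring) γ (by simpa using hγ)
  have h2 := V.smul_mem (MvPolynomial.coeff γ p)⁻¹ this
  rwa [smul_smul, inv_mul_cancel₀ hγ, one_smul] at h2

lemma down {d : ℕ} (V : Submodule ℝ (E d)) (hV : Inv V) (β γ : Fin d → ℕ) (hβ : mon β ∈ V)
    (h : γ ≤ β) : mon γ ∈ V := by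
  classical
  have h1 : ∀ x : X d, ∏ i, (x i + 1) ^ β i =
      ∑ γ ∈ Fintype.piFinset (fun i => Finset.range (β i + 1)),
        ∏ i, (x i ^ γ i * ((β i).choose (γ i) : ℝ)) := by
    intro x
    rw [← Finset.prod_univ_sum (fun i => Finset.range (β i + 1))
      (fun i k => x i ^ k * ((β i).choose k : ℝ))]
    refine Finset.prod_congr rfl fun i _ => ?_
    rw [add_pow]; simp
  have := extract V ((Fintype.piFinset (fun i => Finset.range (β i + 1))).map
      Finsupp.equivFunOnFinite.symm.toEmbedding)
    (fun γ => (∏ i, ((β i).choose (γ i) : ℝ)) • mon γ) (fun a => by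
    convert hV (mon β) hβ a 1 using 1
    ext x
    rw [Finset.sum_map]
    simp only [ContinuousMap.sum_apply, ContinuousMap.comp_apply]
    have := h1 (a * x)
    simp only [mon, ContinuousMap.coe_mk, Pi.add_apply, Pi.one_apply]
    rw [this]
    refine Finset.sum_congr rfl fun γ _ => ?_
    simp [mul_pow, Finset.prod_mul_distrib]
    ring) (Finsupp.equivFunOnFinite.symm γ) (by
      simp only [Finset.mem_map_equiv, Equiv.symm_symm, Equiv.apply_symm_apply,
        Fintype.mem_piFinset, Finset.mem_range]
      exact fun i => Nat.lt_succ_of_le (h i))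
  have hne : (∏ i, ((β i).choose (γ i) : ℝ)) ≠ 0 := by
    rw [Finset.prod_ne_zero_iff]
    intro i _
    exact_mod_cast (Nat.choose_pos (h i)).ne'
  have h2 := V.smul_mem (∏ i, ((β i).choose (γ i) : ℝ))⁻¹ this
  simp only [Finsupp.equivFunOnFinite_symm_apply_apply, Finsupp.coe_equivFunOnFinite_symm] at h2
  rwa [smul_smul, inv_mul_cancel₀ hne, one_smul] at h2

lemma boxes_finite {d : ℕ} (M : Finset (Fin d → ℕ)) : ∃ T : Finset (Fin d → WithTop ℕ),
    ∀ β : Fin d → ℕ, (∃ n ∈ T, ∀ i, (β i : WithTop ℕ) ≤ n i) ↔ ∀ m ∈ M, ¬ m ≤ β := by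
  classical
  induction M using Finset.induction_on with
  | empty => exact ⟨{⊤}, by simp⟩
  | insert m M _ ih =>
    obtain ⟨T, hT⟩ := ih
    refine ⟨((T ×ˢ (Finset.univ.filter fun i => 0 < m i))).image
      (fun p => p.1 ⊓ Function.update ⊤ p.2 ((m p.2 - 1 : ℕ) : WithTop ℕ)), fun β => ?_⟩
    simp only [Finset.mem_insert, forall_eq_or_imp, ← hT]
    constructor
    · rintro ⟨n, hn, h⟩
      simp only [Finset.mem_image, Finset.mem_product, Finset.mem_filter, Finset.mem_univ,
        true_and] at hn
      obtain ⟨⟨n, i⟩, ⟨hn, hi⟩, rfl⟩ := hn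
      refine ⟨fun hle => ?_, n, hn, fun j => (h j).trans inf_le_left⟩
      have := (h i).trans inf_le_right
      simp only [Function.update_self, Nat.cast_le] at this
      have := hle i
      simp only at *
      omega
    · rintro ⟨h1, n, hn, h⟩
      rw [Pi.le_def] at h1
      push Not at h1
      obtain ⟨i, hi⟩ := h1
      refine ⟨_, Finset.mem_image.2 ⟨(n, i), by simp [hn]; omega, rfl⟩, fun j => ?_⟩
      refine le_inf (h j) ?_
      by_cases hji : j = i
      · subst hji
        simp only [Function.update_self, Nat.cast_le]
        omega
      · simp [hji]

lemma boxes {d : ℕ} (D : Set (Fin d → ℕ)) (hD : ∀ β γ, β ∈ D → γ ≤ β → γ ∈ D) :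
    ∃ T : Finset (Fin d → WithTop ℕ),
    ∀ β : Fin d → ℕ, (∃ n ∈ T, ∀ i, (β i : WithTop ℕ) ≤ n i) ↔ β ∈ D := by
  have hfin : {m | Minimal (· ∈ Dᶜ) m}.Finite :=
    WellQuasiOrderedLE.finite_of_isAntichain (setOfPred_minimal_antichain _)
  obtain ⟨T, hT⟩ := boxes_finite hfin.toFinset
  refine ⟨T, fun β => (hT β).trans ?_⟩
  simp only [Set.Finite.mem_toFinset]
  constructor
  · intro h
    by_contra hβ
    obtain ⟨m, hm, hm'⟩ := exists_minimal_le_of_wellFoundedLT (· ∈ Dᶜ) β hβ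
    exact h m hm' hm
  · intro h m hm hle
    exact hm.prop (hD _ _ h hle)

end TDI

open TDI in
theorem stmt_17 (d : ℕ)
    (V : Submodule ℝ C((Fin d → ℝ), ℝ))
    (hclosed : IsClosed (V : Set C((Fin d → ℝ), ℝ)))
    (hinv : ∀ f ∈ V, ∀ a b : Fin d → ℝ,
      (ContinuousMap.comp f ⟨fun x => a * x + b, by continuity⟩ :
        C((Fin d → ℝ), ℝ)) ∈ V) :
    ∃ T : Finset (Fin d → WithTop ℕ),
      (V : Set C((Fin d → ℝ), ℝ)) =
        closure (Submodule.span ℝ {f : C((Fin d → ℝ), ℝ) |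
          ∃ β : Fin d → ℕ, (∃ n ∈ T, ∀ i, (β i : WithTop ℕ) ≤ n i) ∧
            f = ⟨fun x => ∏ i, x i ^ β i, by continuity⟩} :
          Set C((Fin d → ℝ), ℝ)) := by
  have hV : TDI.Inv V := hinv
  obtain ⟨T, hT⟩ := boxes {β | mon β ∈ V} (fun β γ hβ h => down V hV β γ hβ h)
  refine ⟨T, Set.Subset.antisymm ?_ ?_⟩
  · refine (dense_S V hclosed hV Finset.univ).trans (closure_mono ?_)
    rintro f ⟨hf, hfS⟩
    obtain ⟨p, hp⟩ := S_univ f hfS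
    have : f = ∑ γ ∈ p.support, MvPolynomial.coeff γ p • mon γ := by
      ext x
      rw [hp, MvPolynomial.eval_eq', ContinuousMap.sum_apply]
      rfl
    rw [SetLike.mem_coe, this]
    refine Submodule.sum_mem _ fun γ hγ => Submodule.smul_mem _ _ (Submodule.subset_span ?_)
    exact ⟨γ, (hT _).2 (poly_mem V hV f hf p hp γ (by simpa using hγ)), rfl⟩
  · refine closure_minimal ?_ hclosed
    rw [SetLike.coe_subset_coe, Submodule.span_le]
    rintro f ⟨β, hβ, rfl⟩
    exact (hT β).1 hβ
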